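/- (Proposition 1 of the paper.) Let c : ℝ^d × ℝ^d → ℝ≥0 be a measurable ground cost on ℝ^d, let μ and ν be probability measures on ℝ^d, and let α > 0. For λ ∈ [0,1], let μ̃_λ denote the pushforward of μ ⊗ μ under the interpolation map (x, x′) ↦ λ·x + (1−λ)·x′, and define ν̃_λ analogously from ν. Let β(α) denote the Beta(α, α) distribution on [0,1], and let μ̃ = ∫ μ̃_λ dβ(α)(λ) and ν̃ = ∫ ν̃_λ dβ(α)(λ) be the MixUp neighbourhing distributions of μ and ν. Then the optimal transport cost between the neighbourhing distributions is bounded by the expected pairwise cost over independently drawn mixing coefficients: W_c(μ̃, ν̃) ≤ 𝔼_{λ ∼ β(α), λ′ ∼ β(α)} [ W_c(μ̃_λ, ν̃_{λ′}) ]. -/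

import Mathlib

open MeasureTheory
open scoped ENNReal NNReal

/-- A coupling of `(μ, ν)` is a measure on the product space whose first marginal is `μ`
and second marginal is `ν`. -/
def IsCoupling {X Z : Type*} [MeasurableSpace X] [MeasurableSpace Z]
    (π : Measure (X × Z)) (μ : Measure X) (ν : Measure Z) : Prop :=
  π.map Prod.fst = μ ∧ π.map Prod.snd = ν

/-- The optimal transport cost `W_c(μ, ν)`: infimum, over probability measures `π` on the
product space whose marginals are `μ` and `ν`, of `∫ c dπ` (infimum taken in `[0, ∞]`). -/
noncomputable def OTCost {X Z : Type*} [MeasurableSpace X] [MeasurableSpace Z]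
    (c : X × Z → ℝ≥0) (μ : Measure X) (ν : Measure Z) : ℝ≥0∞ :=
  ⨅ π ∈ {π : Measure (X × Z) | IsProbabilityMeasure π ∧ IsCoupling π μ ν},
    ∫⁻ p, (c p : ℝ≥0∞) ∂π

/-- The (unnormalized) Beta(a, a) measure on `[0,1] ⊆ ℝ`, with density
`x ^ (a-1) * (1-x) ^ (a-1)` with respect to Lebesgue measure restricted to `[0,1]`. -/
noncomputable def betaRaw (a : ℝ) : Measure ℝ :=
  (volume.restrict (Set.Icc (0 : ℝ) 1)).withDensity
    fun x => ENNReal.ofReal (x ^ (a - 1) * (1 - x) ^ (a - 1))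

/-- The Beta(a, a) probability distribution `β(a)` on `[0,1] ⊆ ℝ`. -/
noncomputable def betaDist (a : ℝ) : Measure ℝ :=
  (betaRaw a Set.univ)⁻¹ • betaRaw a

/-- The MixUp measure `μ̃_λ`: the pushforward of `μ ⊗ μ` under the interpolation map
`(x, x′) ↦ λ·x + (1−λ)·x′`, i.e. the law of `λ·x + (1−λ)·x′` for `x, x′` i.i.d. from `μ`. -/
noncomputable def mixupMeasure {E : Type*} [MeasurableSpace E] [AddCommMonoid E] [Module ℝ E]
    (μ : Measure E) (l : ℝ) : Measure E :=
  (μ.prod μ).map fun p => l • p.1 + (1 - l) • p.2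

open ProbabilityTheory

/-- **Capacitability** of analytic sets: below the outer measure of the image of the Baire space
there is the measure of the image of a compact box. -/
lemma exists_le_measure_image_box {X : Type*} [TopologicalSpace X]
    [TopologicalSpace.PseudoMetrizableSpace X] [MeasurableSpace X] [BorelSpace X]
    (m : Measure X) [IsFiniteMeasure m] {f : (ℕ → ℕ) → X} (hf : Continuous f) {r : ℝ≥0∞}
    (hr : r < m (Set.range f)) :
    ∃ n : ℕ → ℕ, r ≤ m (f '' Set.Icc 0 n) := by
  have step : ∀ (k : ℕ) (S : Set (ℕ → ℕ)), ∃ j : ℕ,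
      r < m (f '' S) → r < m (f '' (S ∩ {x | x k ≤ j})) := by
    intro k S
    by_cases h : r < m (f '' S)
    · have hU : f '' S = ⋃ j : ℕ, f '' (S ∩ {x | x k ≤ j}) := by
        rw [← Set.image_iUnion, ← Set.inter_iUnion]
        congr 1
        refine (Set.inter_eq_left.2 fun x _ => Set.mem_iUnion.2 ⟨x k, le_refl (x k)⟩).symm
      have hmono : Monotone fun j : ℕ => f '' (S ∩ {x | x k ≤ j}) := fun a b hab =>
        Set.image_mono (Set.inter_subset_inter_right _ fun x (hx : x k ≤ a) => hx.trans hab)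
      rw [hU, hmono.measure_iUnion, lt_iSup_iff] at h
      exact h.imp fun j hj _ => hj
    · exact ⟨0, fun h' => absurd h' h⟩
  choose J hJ using step
  let S : ℕ → Set (ℕ → ℕ) := fun k => Nat.rec Set.univ (fun k S => S ∩ {x | x k ≤ J k S}) k
  let n : ℕ → ℕ := fun k => J k (S k)
  have hS : ∀ k, S k = {x | ∀ i < k, x i ≤ n i} := by
    intro k
    induction k with
    | zero => ext x; simp [S]
    | succ k ih =>
      have : S (k + 1) = S k ∩ {x | x k ≤ n k} := rfl
      rw [this, ih]
      ext x
      simp only [Set.mem_inter_iff, Set.mem_ofPred_eq, Nat.lt_succ_iff_lt_or_eq]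
      grind
  have hlt : ∀ k, r < m (f '' S k) := by
    intro k
    induction k with
    | zero => simpa [S] using hr
    | succ k ih => exact hJ k (S k) ih
  refine ⟨n, ?_⟩
  rw [Set.measure_eq_iInf_isOpen]
  refine le_iInf₂ fun U hKU => le_iInf fun hU => ?_
  suffices h : ∃ k, f '' S k ⊆ U by
    obtain ⟨k, hk⟩ := h
    exact (hlt k).le.trans (measure_mono hk)
  by_contra! hcon
  have hx : ∀ k, ∃ x ∈ S k, f x ∉ U := fun k => by
    obtain ⟨_, ⟨x, hx, rfl⟩, hxU⟩ := Set.not_subset.1 (hcon k)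
    exact ⟨x, hx, hxU⟩
  choose x hxS hxU using hx
  obtain ⟨y, hyK, φ, hφ, hy⟩ := (isCompact_Icc (a := 0) (b := n)).tendsto_subseq
    (x := fun k i => min (x k i) (n i)) fun k =>
      ⟨fun i => Nat.zero_le _, fun i => min_le_right (x k i) (n i)⟩
  have hxy : Filter.Tendsto (x ∘ φ) Filter.atTop (nhds y) := by
    rw [tendsto_pi_nhds] at hy ⊢
    intro i
    refine (hy i).congr' ?_
    filter_upwards [Filter.eventually_gt_atTop i] with k hk
    have := hxS (φ k)
    rw [hS] at this
    exact min_eq_left (this i (hk.trans_le hφ.le_apply))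
  have hyU : f y ∈ U := hKU ⟨y, hyK, rfl⟩
  obtain ⟨k, hk⟩ := ((hf.tendsto y).comp hxy |>.eventually (hU.mem_nhds hyU)).exists
  exact hxU (φ k) hk

/-- A continuous map on the Cantor space has a measurable section. -/
lemma exists_measurable_section_of_continuous_cantor {X : Type*} [TopologicalSpace X] [T2Space X]
    [MeasurableSpace X] [BorelSpace X] {g : (ℕ → Bool) → X} (hg : Continuous g) :
    ∃ s : X → ℕ → Bool, Measurable s ∧ ∀ x ∈ Set.range g, g (s x) = x := by
  let G : cantorSet → X := g ∘ cantorSetHomeomorphNatToBool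
  have hG : Continuous G := hg.comp (Homeomorph.continuous _)
  have : CompactSpace cantorSet := isCompact_iff_compactSpace.1 isCompact_cantorSet
  let A : X → Set ℝ := fun x => Subtype.val '' (G ⁻¹' {x})
  have hAc : ∀ x, IsCompact (A x) := fun x =>
    ((isClosed_singleton.preimage hG).isCompact).image continuous_subtype_val
  have hrange : Set.range G = Set.range g := cantorSetHomeomorphNatToBool.surjective.range_comp g
  have hAne : ∀ x ∈ Set.range G, (A x).Nonempty := by
    rintro _ ⟨t, rfl⟩
    exact ⟨t, t, rfl, rfl⟩
  have hAe : ∀ x ∉ Set.range G, A x = ∅ := by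
    intro x hx
    refine Set.image_eq_empty.2 (Set.eq_empty_of_forall_notMem fun t ht => hx ⟨t, ht⟩)
  have hmem : ∀ x, sInf (A x) ∈ cantorSet := by
    intro x
    by_cases hx : x ∈ Set.range G
    · obtain ⟨t, -, ht⟩ := (hAc x).sInf_mem (hAne x hx)
      rw [← ht]
      exact t.2
    · rw [hAe x hx, Real.sInf_empty]
      exact zero_mem_cantorSet
  have hmeas : Measurable fun x => sInf (A x) := by
    refine measurable_of_Iic fun a => ?_
    have key : (fun x => sInf (A x)) ⁻¹' Set.Iic a =
        G '' {t | (t : ℝ) ≤ a} ∪ ((Set.range G)ᶜ ∩ {_x | (0 : ℝ) ≤ a}) := by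
      ext x
      simp only [Set.mem_preimage, Set.mem_Iic, Set.mem_union, Set.mem_inter_iff,
        Set.mem_compl_iff, Set.mem_ofPred_eq]
      by_cases hx : x ∈ Set.range G
      · simp only [hx, not_true_eq_false, false_and, or_false]
        constructor
        · intro h
          obtain ⟨t, ht, hta⟩ := (hAc x).sInf_mem (hAne x hx)
          exact ⟨t, hta.trans_le h, ht⟩
        · rintro ⟨t, ht, rfl⟩
          exact (csInf_le (hAc _).bddBelow ⟨t, rfl, rfl⟩).trans ht
      · simp only [hAe x hx, Real.sInf_empty, hx, not_false_eq_true, true_and]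
        exact ⟨Or.inr, fun h => h.resolve_left fun ⟨t, _, ht⟩ => hx ⟨t, ht⟩⟩
    rw [key]
    refine MeasurableSet.union ?_ (MeasurableSet.inter ?_ (MeasurableSet.const _))
    · exact ((isClosed_le continuous_subtype_val continuous_const).isCompact.image hG).measurableSet
    · exact (isCompact_range hG).measurableSet.compl
  refine ⟨fun x => cantorSetHomeomorphNatToBool ⟨sInf (A x), hmem x⟩,
    (Homeomorph.continuous _).measurable.comp (hmeas.subtype_mk), fun x hx => ?_⟩
  rw [← hrange] at hx
  obtain ⟨t, ht, htx⟩ := (hAc x).sInf_mem (hAne x hx)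
  have hxt : (⟨sInf (A x), hmem x⟩ : cantorSet) = t := Subtype.ext htx.symm
  exact (congrArg G hxt).trans ht

/-- A continuous map on a compact metrizable set has a measurable section. -/
lemma IsCompact.exists_measurable_section {X Y : Type*} [TopologicalSpace X] [T2Space X]
    [MeasurableSpace X] [BorelSpace X] [TopologicalSpace Y]
    [TopologicalSpace.MetrizableSpace Y] [MeasurableSpace Y] [BorelSpace Y]
    {K : Set Y} (hK : IsCompact K) (hne : K.Nonempty) {f : Y → X} (hf : Continuous f) :
    ∃ s : X → Y, Measurable s ∧ ∀ x ∈ f '' K, f (s x) = x := by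
  have : CompactSpace K := isCompact_iff_compactSpace.1 hK
  have : Nonempty K := hne.to_subtype
  let : MetricSpace K := TopologicalSpace.metrizableSpaceMetric K
  obtain ⟨φ, hφ, hφs⟩ := exists_nat_bool_continuous_surjective_of_compact K
  have hψ : Continuous fun z => (φ z : Y) := continuous_subtype_val.comp hφ
  obtain ⟨s, hs, hsec⟩ := exists_measurable_section_of_continuous_cantor (hf.comp hψ)
  refine ⟨fun x => φ (s x), hψ.measurable.comp hs, ?_⟩
  rintro _ ⟨y, hy, rfl⟩
  obtain ⟨z, hz⟩ := hφs ⟨y, hy⟩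
  exact hsec (f y) ⟨z, by simp [hz]⟩

/-- **Measurable selection**: a measurable set in a product of standard Borel spaces has a
measurable section over a measurable subset of full measure of its projection. -/
lemma MeasurableSet.exists_measurable_selection {X Y : Type*} [MeasurableSpace X]
    [StandardBorelSpace X] [MeasurableSpace Y] [StandardBorelSpace Y] [Nonempty Y]
    {G : Set (X × Y)} (hG : MeasurableSet G) (m : Measure X) [IsFiniteMeasure m] :
    ∃ (B : Set X) (s : X → Y), MeasurableSet B ∧ Measurable s ∧ m (Prod.fst '' G) ≤ m B ∧
      ∀ x ∈ B, (x, s x) ∈ G := by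
  let := upgradeStandardBorel X
  let := upgradeStandardBorel Y
  by_cases h0 : m (Prod.fst '' G) = 0
  · exact ⟨∅, fun _ => Classical.arbitrary Y, .empty, measurable_const, by simp [h0], by simp⟩
  have hGa : AnalyticSet G := hG.analyticSet
  rw [AnalyticSet] at hGa
  obtain rfl | ⟨f, hf, rfl⟩ := hGa
  · simp at h0
  have hf₁ : Continuous fun z => (f z).1 := continuous_fst.comp hf
  have himage : Prod.fst '' Set.range f = Set.range fun z => (f z).1 := (Set.range_comp _ _).symm
  rw [himage] at h0 ⊢
  obtain ⟨r, -, hrlt, hr⟩ := exists_seq_strictMono_tendsto' (pos_iff_ne_zero.2 h0)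
  choose n hn using fun p => exists_le_measure_image_box m hf₁ (hrlt p).2
  choose t ht hsec using fun p =>
    (isCompact_Icc (a := 0) (b := n p)).exists_measurable_section ⟨0, by simp⟩ hf₁
  let C : ℕ → Set X := fun p => (fun z => (f z).1) '' Set.Icc 0 (n p)
  have hC : ∀ p, MeasurableSet (C p) := fun p => (isCompact_Icc.image hf₁).measurableSet
  obtain ⟨s, hs, hst⟩ := exists_measurable_piecewise (disjointed C)
    (fun p => MeasurableSet.disjointed hC p) (fun p x => (f (t p x)).2)
    (fun p => (continuous_snd.comp hf).measurable.comp (ht p)) fun p q hpq x hx =>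
      (Set.disjoint_left.1 (disjoint_disjointed C hpq) hx.1 hx.2).elim
  refine ⟨⋃ p, C p, s, .iUnion hC, hs, ?_, ?_⟩
  · exact le_of_tendsto' hr fun p => (hn p).trans (measure_mono (Set.subset_iUnion C p))
  · intro x hx
    rw [← iUnion_disjointed] at hx
    obtain ⟨p, hp⟩ := Set.mem_iUnion.1 hx
    refine ⟨t p x, Prod.ext (hsec p x (disjointed_subset C p hp)) (hst p hp).symm⟩

/-- Projections of measurable sets of standard Borel spaces are universally measurable. -/
lemma MeasurableSet.nullMeasurableSet_image_fst {X Y : Type*} [MeasurableSpace X]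
    [StandardBorelSpace X] [MeasurableSpace Y] [StandardBorelSpace Y]
    {G : Set (X × Y)} (hG : MeasurableSet G) (m : Measure X) [IsFiniteMeasure m] :
    NullMeasurableSet (Prod.fst '' G) m := by
  cases isEmpty_or_nonempty Y
  · rw [Set.eq_empty_of_isEmpty G, Set.image_empty]
    exact nullMeasurableSet_empty
  obtain ⟨B, s, hB, -, hm, hBG⟩ := hG.exists_measurable_selection m
  have hsub : B ⊆ Prod.fst '' G := fun x hx => ⟨_, hBG x hx, rfl⟩
  exact hB.nullMeasurableSet.congr
    (ae_eq_of_subset_of_measure_ge hsub hm hB.nullMeasurableSet (measure_ne_top _ _))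

/-- The probability measures on a standard Borel space are measurably parametrized by a standard
Borel space, namely through the values at the rationals of the cumulative distribution function of
their image on the real line. -/
lemma exists_measurable_parametrization_probabilityMeasure (Z : Type*) [MeasurableSpace Z]
    [StandardBorelSpace Z] [Nonempty Z] :
    ∃ D : (ℚ → ℝ) → Measure Z, Measurable D ∧ (∀ F, IsProbabilityMeasure (D F)) ∧
      ∀ π : Measure Z, IsProbabilityMeasure π → ∃ F, D F = π := by
  have he := measurableEmbedding_embeddingReal Z
  obtain ⟨g, hg, hge⟩ := he.exists_measurable_extend measurable_id fun _ => ‹Nonempty Z›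
  have hid : Measurable (fun F : ℚ → ℝ => F) := measurable_id
  refine ⟨fun F => (stieltjesOfMeasurableRat (fun F : ℚ → ℝ => F) hid F).measure.map g,
    (Measure.measurable_map g hg).comp (measurable_measure_stieltjesOfMeasurableRat hid),
    fun F => Measure.isProbabilityMeasure_map hg.aemeasurable, fun π hπ => ?_⟩
  let ρ : Measure ℝ := π.map (embeddingReal Z)
  have hρ : IsProbabilityMeasure ρ := Measure.isProbabilityMeasure_map he.measurable.aemeasurable
  have hpt : IsRatStieltjesPoint (fun F : ℚ → ℝ => F) fun q => cdf ρ q :=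
    { mono := fun a b hab => monotone_cdf ρ (by exact_mod_cast hab)
      tendsto_atTop_one := (tendsto_cdf_atTop ρ).comp
        (tendsto_ratCast_atTop_iff.2 Filter.tendsto_id)
      tendsto_atBot_zero := (tendsto_cdf_atBot ρ).comp
        (tendsto_ratCast_atBot_iff.2 Filter.tendsto_id)
      iInf_rat_gt_eq := fun t => by
        refine Eq.trans ?_ ((cdf ρ).iInf_rat_gt_eq (t : ℝ))
        exact Equiv.iInf_congr (Equiv.subtypeEquivRight fun q => by simp) fun q => rfl }
  refine ⟨fun q => cdf ρ q, ?_⟩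
  have hm : (stieltjesOfMeasurableRat (fun F : ℚ → ℝ => F) hid fun q => cdf ρ q).measure = ρ := by
    refine ext_of_generate_finite _ Real.borel_eq_generateFrom_Iic_rat Real.isPiSystem_Iic_rat
      ?_ (by simp)
    simp only [Set.iUnion_singleton_eq_range, Set.mem_range, forall_exists_index,
      forall_apply_eq_imp_iff]
    intro q
    rw [measure_stieltjesOfMeasurableRat_Iic, stieltjesOfMeasurableRat_eq,
      toRatCDF_of_isRatStieltjesPoint hpt, ofReal_cdf]
  beta_reduce
  rw [hm, Measure.map_map hg he.measurable, hge, Measure.map_id]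

/-- Two measurable families of probability measures on a standard Borel space agree on a
measurable set. -/
lemma measurableSet_eq_probabilityMeasure {Ω Z : Type*} [MeasurableSpace Ω] [MeasurableSpace Z]
    [StandardBorelSpace Z] {κ η : Ω → Measure Z} (hκ : Measurable κ) (hη : Measurable η)
    [∀ a, IsProbabilityMeasure (κ a)] [∀ a, IsProbabilityMeasure (η a)] :
    MeasurableSet {a | κ a = η a} := by
  have he := measurableEmbedding_embeddingReal Z
  have key : {a | κ a = η a} = ⋂ q : ℚ, {a | κ a (embeddingReal Z ⁻¹' Set.Iic (q : ℝ)) =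
      η a (embeddingReal Z ⁻¹' Set.Iic (q : ℝ))} := by
    ext a
    simp only [Set.mem_ofPred_eq, Set.mem_iInter]
    refine ⟨fun h q => by rw [h], fun h => ?_⟩
    have hp : ∀ ρ : Measure Z, IsProbabilityMeasure ρ →
        IsProbabilityMeasure (ρ.map (embeddingReal Z)) := fun ρ _ =>
      Measure.isProbabilityMeasure_map he.measurable.aemeasurable
    have := hp (κ a) inferInstance
    have := hp (η a) inferInstance
    have hmap : (κ a).map (embeddingReal Z) = (η a).map (embeddingReal Z) := by
      refine ext_of_generate_finite _ Real.borel_eq_generateFrom_Iic_rat Real.isPiSystem_Iic_rat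
        ?_ (by simp)
      simp only [Set.iUnion_singleton_eq_range, Set.mem_range, forall_exists_index,
        forall_apply_eq_imp_iff]
      intro q
      rw [Measure.map_apply he.measurable measurableSet_Iic,
        Measure.map_apply he.measurable measurableSet_Iic, h q]
    rw [← he.comap_map (κ a), hmap, he.comap_map]
  rw [key]
  refine .iInter fun q => measurableSet_eq_fun ?_ ?_
  · exact (Measure.measurable_coe (he.measurable measurableSet_Iic)).comp hκ
  · exact (Measure.measurable_coe (he.measurable measurableSet_Iic)).comp hη

lemma map_bind_congr_ae {Ω V Y : Type*} [MeasurableSpace Ω] [MeasurableSpace V] [MeasurableSpace Y]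
    {m : Measure Ω} {π : Ω → Measure V} (hπ : Measurable π) {f : V → Y} (hf : Measurable f)
    {ρ : Ω → Measure Y} (hρ : ∀ᵐ x ∂m, (π x).map f = ρ x) :
    (m.bind π).map f = m.bind ρ := by
  rw [← Measure.bind_congr_right hρ]
  ext A hA
  rw [Measure.map_apply hf hA, Measure.bind_apply (hf hA) hπ.aemeasurable,
    Measure.bind_apply (f := fun x => (π x).map f) hA
      ((Measure.measurable_map f hf).comp hπ).aemeasurable]
  simp only [Measure.map_apply hf hA]

lemma OTCost_lt_iff {X Z : Type*} [MeasurableSpace X] [MeasurableSpace Z] {c : X × Z → ℝ≥0}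
    {μ : Measure X} {ν : Measure Z} {t : ℝ≥0∞} :
    OTCost c μ ν < t ↔ ∃ π : Measure (X × Z), IsProbabilityMeasure π ∧ IsCoupling π μ ν ∧
      ∫⁻ p, (c p : ℝ≥0∞) ∂π < t := by
  simp [OTCost, iInf_lt_iff, and_assoc]

section Disintegration

variable {S T X Z : Type*} [MeasurableSpace S] [MeasurableSpace T] [MeasurableSpace X]
  [StandardBorelSpace X] [MeasurableSpace Z] [StandardBorelSpace Z]
  {c : X × Z → ℝ≥0} {κ : S → Measure X} {η : T → Measure Z}
  [∀ a, IsProbabilityMeasure (κ a)] [∀ b, IsProbabilityMeasure (η b)]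

lemma measurableSet_isCoupling_lintegral_lt {V : Type*} [MeasurableSpace V] (hc : Measurable c)
    (hκ : Measurable κ) (hη : Measurable η) {D : V → Measure (X × Z)} (hD : Measurable D)
    [∀ v, IsProbabilityMeasure (D v)] {t : S × T → ℝ≥0∞} (ht : Measurable t) :
    MeasurableSet {p : (S × T) × V | IsCoupling (D p.2) (κ p.1.1) (η p.1.2) ∧
      ∫⁻ z, (c z : ℝ≥0∞) ∂(D p.2) < t p.1} := by
  have h₁ : ∀ v, IsProbabilityMeasure ((D v).map Prod.fst) := fun v =>
    Measure.isProbabilityMeasure_map measurable_fst.aemeasurable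
  have h₂ : ∀ v, IsProbabilityMeasure ((D v).map Prod.snd) := fun v =>
    Measure.isProbabilityMeasure_map measurable_snd.aemeasurable
  refine .inter (.inter ?_ ?_) (measurableSet_lt ?_ (ht.comp measurable_fst))
  · exact measurableSet_eq_probabilityMeasure (κ := fun p : (S × T) × V => (D p.2).map Prod.fst)
      (η := fun p => κ p.1.1)
      ((Measure.measurable_map _ measurable_fst).comp (hD.comp measurable_snd))
      (hκ.comp (measurable_fst.comp measurable_fst))
  · exact measurableSet_eq_probabilityMeasure (κ := fun p : (S × T) × V => (D p.2).map Prod.snd)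
      (η := fun p => η p.1.2)
      ((Measure.measurable_map _ measurable_snd).comp (hD.comp measurable_snd))
      (hη.comp (measurable_snd.comp measurable_fst))
  · exact (Measure.measurable_lintegral hc.coe_nnreal_ennreal).comp (hD.comp measurable_snd)

variable [StandardBorelSpace S] [StandardBorelSpace T] [Nonempty X] [Nonempty Z]

lemma aemeasurable_OTCost (hc : Measurable c) (hκ : Measurable κ) (hη : Measurable η)
    (m : Measure (S × T)) [IsFiniteMeasure m] :
    AEMeasurable (fun x => OTCost c (κ x.1) (η x.2)) m := by
  obtain ⟨D, hD, hDp, hDs⟩ := exists_measurable_parametrization_probabilityMeasure (X × Z)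
  refine NullMeasurable.aemeasurable (measurable_of_Iio (δ := NullMeasurableSpace (S × T) m) ?_)
  intro t
  have hG := measurableSet_isCoupling_lintegral_lt hc hκ hη hD (measurable_const (a := t))
  suffices h : (fun x : S × T => OTCost c (κ x.1) (η x.2)) ⁻¹' Set.Iio t = Prod.fst ''
      {p : (S × T) × (ℚ → ℝ) | IsCoupling (D p.2) (κ p.1.1) (η p.1.2) ∧
        ∫⁻ z, (c z : ℝ≥0∞) ∂(D p.2) < t} by
    have hnull : NullMeasurableSet
        ((fun x : S × T => OTCost c (κ x.1) (η x.2)) ⁻¹' Set.Iio t) m := by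
      rw [h]
      exact hG.nullMeasurableSet_image_fst m
    exact hnull
  ext x
  simp only [Set.mem_preimage, Set.mem_Iio, OTCost_lt_iff]
  constructor
  · rintro ⟨π, hπ, h⟩
    obtain ⟨F, rfl⟩ := hDs π hπ
    exact ⟨(x, F), h, rfl⟩
  · rintro ⟨⟨x, F⟩, h, rfl⟩
    exact ⟨D F, hDp F, h⟩

/-- Couplings with cost arbitrarily close to the transport cost can be selected measurably. -/
lemma exists_measurable_coupling_lintegral_lt (hc : Measurable c) (hκ : Measurable κ)
    (hη : Measurable η) (m : Measure (S × T)) [IsFiniteMeasure m] {t : S × T → ℝ≥0∞}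
    (ht : Measurable t) (hlt : ∀ᵐ x ∂m, OTCost c (κ x.1) (η x.2) < t x) :
    ∃ π : S × T → Measure (X × Z), Measurable π ∧ (∀ x, IsProbabilityMeasure (π x)) ∧
      ∀ᵐ x ∂m, IsCoupling (π x) (κ x.1) (η x.2) ∧ ∫⁻ p, (c p : ℝ≥0∞) ∂(π x) < t x := by
  obtain ⟨D, hD, hDp, hDs⟩ := exists_measurable_parametrization_probabilityMeasure (X × Z)
  have hG := measurableSet_isCoupling_lintegral_lt hc hκ hη hD ht
  obtain ⟨B, s, hB, hs, hm, hBG⟩ := hG.exists_measurable_selection m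
  refine ⟨fun x => D (s x), hD.comp hs, fun x => hDp _, ?_⟩
  have hBuniv : m Set.univ ≤ m B := by
    refine le_trans (measure_mono_ae ?_) hm
    filter_upwards [hlt] with x hx _
    obtain ⟨π, hπ, h⟩ := OTCost_lt_iff.1 hx
    obtain ⟨F, rfl⟩ := hDs π hπ
    exact ⟨(x, F), h, rfl⟩
  have hBae : ∀ᵐ x ∂m, x ∈ B :=
    (ae_iff_measure_eq hB.nullMeasurableSet).2
      (le_antisymm (measure_mono (Set.subset_univ _)) hBuniv)
  filter_upwards [hBae] with x hx using hBG x hx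

/-- The transport cost between mixtures is at most the average transport cost between their
components, for independent mixing parameters. -/
theorem OTCost_bind_le_lintegral (hc : Measurable c) (hκ : Measurable κ) (hη : Measurable η)
    (P : Measure S) (Q : Measure T) [IsProbabilityMeasure P] [IsProbabilityMeasure Q] :
    OTCost c (P.bind κ) (Q.bind η) ≤ ∫⁻ a, ∫⁻ b, OTCost c (κ a) (η b) ∂Q ∂P := by
  have hW := aemeasurable_OTCost hc hκ hη (P.prod Q)
  rw [← lintegral_prod _ hW]
  refine ENNReal.le_of_forall_pos_le_add fun ε hε hfin => ?_
  have hlt : ∀ᵐ x ∂(P.prod Q), OTCost c (κ x.1) (η x.2) < hW.mk _ x + ε := by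
    filter_upwards [hW.ae_eq_mk, ae_lt_top' hW hfin.ne] with x hx hx'
    rw [← hx]
    exact ENNReal.lt_add_right hx'.ne (by simpa using hε.ne')
  obtain ⟨π, hπ, hπp, hπc⟩ := exists_measurable_coupling_lintegral_lt hc hκ hη (P.prod Q)
    (hW.measurable_mk.add_const _) hlt
  have hprob : IsProbabilityMeasure ((P.prod Q).bind π) :=
    ⟨by simp [Measure.bind_apply MeasurableSet.univ hπ.aemeasurable]⟩
  have hcoup : IsCoupling ((P.prod Q).bind π) (P.bind κ) (Q.bind η) := by
    constructor
    · rw [map_bind_congr_ae hπ measurable_fst (hπc.mono fun x hx => hx.1.1)]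
      ext A hA
      rw [Measure.bind_apply (f := fun x : S × T => κ x.1) hA (hκ.comp measurable_fst).aemeasurable,
        Measure.bind_apply hA hκ.aemeasurable]
      exact measurePreserving_fst.lintegral_comp ((Measure.measurable_coe hA).comp hκ)
    · rw [map_bind_congr_ae hπ measurable_snd (hπc.mono fun x hx => hx.1.2)]
      ext A hA
      rw [Measure.bind_apply (f := fun x : S × T => η x.2) hA (hη.comp measurable_snd).aemeasurable,
        Measure.bind_apply hA hη.aemeasurable]
      exact measurePreserving_snd.lintegral_comp ((Measure.measurable_coe hA).comp hη)
  calc OTCost c (P.bind κ) (Q.bind η)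
      ≤ ∫⁻ p, (c p : ℝ≥0∞) ∂((P.prod Q).bind π) := iInf₂_le _ ⟨hprob, hcoup⟩
    _ = ∫⁻ x, ∫⁻ p, (c p : ℝ≥0∞) ∂(π x) ∂(P.prod Q) :=
        Measure.lintegral_bind hπ.aemeasurable hc.coe_nnreal_ennreal.aemeasurable
    _ ≤ ∫⁻ x, (hW.mk _ x + ε) ∂(P.prod Q) := lintegral_mono_ae (hπc.mono fun x hx => hx.2.le)
    _ = ∫⁻ x, OTCost c (κ x.1) (η x.2) ∂(P.prod Q) + ε := by
        rw [lintegral_add_right _ measurable_const, lintegral_congr_ae hW.ae_eq_mk]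
        simp

end Disintegration

lemma isProbabilityMeasure_betaDist {a : ℝ} (ha : 0 < a) : IsProbabilityMeasure (betaDist a) := by
  have h := lintegral_betaPDF_eq_one ha ha
  have hB : 0 < 1 / beta a a := one_div_pos.2 (beta_pos ha ha)
  have hraw : betaRaw a Set.univ =
      ∫⁻ x in Set.Ioo (0 : ℝ) 1, ENNReal.ofReal (x ^ (a - 1) * (1 - x) ^ (a - 1)) := by
    rw [betaRaw, withDensity_apply _ .univ, Measure.restrict_univ,
      restrict_Ioo_eq_restrict_Icc]
  rw [lintegral_betaPDF] at h
  simp_rw [mul_assoc, ENNReal.ofReal_mul hB.le] at h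
  rw [lintegral_const_mul _ (by fun_prop), ← hraw] at h
  have h0 : betaRaw a Set.univ ≠ 0 := fun h' => by simp [h'] at h
  have htop : betaRaw a Set.univ ≠ ∞ := fun h' => by
    rw [h', ENNReal.mul_top (by simpa using beta_pos ha ha)] at h
    exact ENNReal.top_ne_one h
  exact ⟨by simp [betaDist, ENNReal.inv_mul_cancel h0 htop]⟩

section mixupMeasure

variable {E : Type*} [MeasurableSpace E] [AddCommMonoid E] [Module ℝ E] [MeasurableAdd₂ E]
  [MeasurableSMul₂ ℝ E] (μ : Measure E) [IsProbabilityMeasure μ]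

lemma isProbabilityMeasure_mixupMeasure (l : ℝ) : IsProbabilityMeasure (mixupMeasure μ l) :=
  Measure.isProbabilityMeasure_map (by fun_prop)

lemma measurable_mixupMeasure : Measurable (mixupMeasure μ) := by
  refine Measure.measurable_of_measurable_coe _ fun A hA => ?_
  have hf : Measurable fun q : ℝ × E × E => q.1 • q.2.1 + (1 - q.1) • q.2.2 := by fun_prop
  have : (fun l => mixupMeasure μ l A) = fun l => (μ.prod μ)
      (Prod.mk l ⁻¹' ((fun q : ℝ × E × E => q.1 • q.2.1 + (1 - q.1) • q.2.2) ⁻¹' A)) := by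
    ext l
    rw [mixupMeasure, Measure.map_apply (by fun_prop) hA]
    rfl
  rw [this]
  exact measurable_measure_prodMk_left (hf hA)

end mixupMeasure

/-- Proposition 1: the optimal transport cost between the MixUp neighbourhing distributions
`μ̃ = ∫ μ̃_λ dβ(α)(λ)` and `ν̃ = ∫ ν̃_λ dβ(α)(λ)` is bounded by the expected pairwise cost
over independently drawn mixing coefficients:
`W_c(μ̃, ν̃) ≤ 𝔼_{λ, λ′ ∼ β(α)} [ W_c(μ̃_λ, ν̃_{λ′}) ]`. -/
theorem OTCost_mixup_le_expectation_pair
    (d : ℕ)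
    (c : EuclideanSpace ℝ (Fin d) × EuclideanSpace ℝ (Fin d) → ℝ≥0) (hc : Measurable c)
    (μ ν : Measure (EuclideanSpace ℝ (Fin d)))
    [IsProbabilityMeasure μ] [IsProbabilityMeasure ν]
    (α : ℝ) (hα : 0 < α) :
    OTCost c ((betaDist α).bind (mixupMeasure μ)) ((betaDist α).bind (mixupMeasure ν)) ≤
      ∫⁻ l, ∫⁻ l', OTCost c (mixupMeasure μ l) (mixupMeasure ν l')
        ∂(betaDist α) ∂(betaDist α) := by
  have := isProbabilityMeasure_betaDist hα
  have := isProbabilityMeasure_mixupMeasure μ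
  have := isProbabilityMeasure_mixupMeasure ν
  exact OTCost_bind_le_lintegral hc (measurable_mixupMeasure μ) (measurable_mixupMeasure ν) _ _
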